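/- With the notation of the two-site update: let D be a real matrix, S the diagonal singular value matrix of a unit-Frobenius-norm matrix, d a truncation rank, and ε = 1 − √(Σ_{i≤d} S_{ii}²). Then Σ_{i>d} D_{ii} S_{ii} ≤ √((Σ_{i>d} D_{ii}²)(2ε − ε²)) ≤ ‖D‖_F √(2ε), assuming ε ≤ 1. Consequently, 2 Σ_{i>d} D_{ii} S_{ii} ≤ √(8ε) ‖D‖_F. -/

import Mathlib

/-- Frobenius norm of a real square matrix. -/
noncomputable def frob {n : ℕ} (M : Matrix (Fin n) (Fin n) ℝ) : ℝ :=
  Real.sqrt (∑ i, ∑ j, (M i j) ^ 2)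

/-- let `S` be the vector of singular values (nonnegative,
decreasing, with `Σ S_i² = 1`), `d` a truncation rank, and
`ε = 1 - √(Σ_{i<d} S_i²)`. For any matrix `D`,
`Σ_{i≥d} D_ii S_i ≤ √((Σ_{i≥d} D_ii²)(2ε - ε²)) ≤ ‖D‖_F √(2ε)`,
and consequently `2 Σ_{i≥d} D_ii S_i ≤ √(8ε) ‖D‖_F`. -/
theorem truncation_cauchy_schwarz_bound {n : ℕ}
    (S : Fin n → ℝ) (hSnonneg : ∀ i, 0 ≤ S i)
    (hSmono : ∀ i j : Fin n, i ≤ j → S j ≤ S i)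
    (hSnorm : ∑ i, (S i) ^ 2 = 1)
    (d : ℕ)
    (ε : ℝ)
    (hε : ε = 1 - Real.sqrt (∑ i ∈ Finset.univ.filter (fun i : Fin n => (i : ℕ) < d), (S i) ^ 2))
    (hε1 : ε ≤ 1)
    (D : Matrix (Fin n) (Fin n) ℝ) :
    (∑ i ∈ Finset.univ.filter (fun i : Fin n => d ≤ (i : ℕ)), D i i * S i)
        ≤ Real.sqrt ((∑ i ∈ Finset.univ.filter (fun i : Fin n => d ≤ (i : ℕ)), (D i i) ^ 2)
            * (2 * ε - ε ^ 2)) ∧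
      Real.sqrt ((∑ i ∈ Finset.univ.filter (fun i : Fin n => d ≤ (i : ℕ)), (D i i) ^ 2)
            * (2 * ε - ε ^ 2)) ≤ frob D * Real.sqrt (2 * ε) ∧
      2 * (∑ i ∈ Finset.univ.filter (fun i : Fin n => d ≤ (i : ℕ)), D i i * S i)
        ≤ Real.sqrt (8 * ε) * frob D := by
  have hsplit : ∑ i ∈ Finset.univ.filter (fun i : Fin n => (i : ℕ) < d), (S i) ^ 2
      + ∑ i ∈ Finset.univ.filter (fun i : Fin n => d ≤ (i : ℕ)), (S i) ^ 2 = 1 := by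
    rw [← hSnorm, ← Finset.sum_filter_add_sum_filter_not Finset.univ
      (fun i : Fin n => (i : ℕ) < d)]
    simp only [not_lt]
  have hA0 : 0 ≤ ∑ i ∈ Finset.univ.filter (fun i : Fin n => (i : ℕ) < d), (S i) ^ 2 :=
    Finset.sum_nonneg fun i _ => sq_nonneg _
  have hB0 : 0 ≤ ∑ i ∈ Finset.univ.filter (fun i : Fin n => d ≤ (i : ℕ)), (S i) ^ 2 :=
    Finset.sum_nonneg fun i _ => sq_nonneg _
  have hsq := Real.sq_sqrt hA0
  have htail : ∑ i ∈ Finset.univ.filter (fun i : Fin n => d ≤ (i : ℕ)), (S i) ^ 2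
      = 2 * ε - ε ^ 2 := by
    have h1 : Real.sqrt (∑ i ∈ Finset.univ.filter (fun i : Fin n => (i : ℕ) < d), (S i) ^ 2)
        = 1 - ε := by linarith
    rw [h1] at hsq
    nlinarith
  have h1 : (∑ i ∈ Finset.univ.filter (fun i : Fin n => d ≤ (i : ℕ)), D i i * S i)
        ≤ Real.sqrt ((∑ i ∈ Finset.univ.filter (fun i : Fin n => d ≤ (i : ℕ)), (D i i) ^ 2)
            * (2 * ε - ε ^ 2)) := by
    rw [← htail]
    exact Real.le_sqrt_of_sq_le (Finset.sum_mul_sq_le_sq_mul_sq _ _ _)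
  have hD : ∑ i ∈ Finset.univ.filter (fun i : Fin n => d ≤ (i : ℕ)), (D i i) ^ 2
      ≤ ∑ i, ∑ j, (D i j) ^ 2 := by
    refine (Finset.sum_le_sum_of_subset_of_nonneg (Finset.filter_subset _ _)
      fun i _ _ => sq_nonneg _).trans (Finset.sum_le_sum fun i _ => ?_)
    exact Finset.single_le_sum (f := fun j => (D i j) ^ 2) (fun j _ => sq_nonneg _)
      (Finset.mem_univ i)
  have hF0 : 0 ≤ ∑ i, ∑ j, (D i j) ^ 2 :=
    Finset.sum_nonneg fun i _ => Finset.sum_nonneg fun j _ => sq_nonneg _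
  have h2 : Real.sqrt ((∑ i ∈ Finset.univ.filter (fun i : Fin n => d ≤ (i : ℕ)), (D i i) ^ 2)
            * (2 * ε - ε ^ 2)) ≤ frob D * Real.sqrt (2 * ε) := by
    rw [frob, ← Real.sqrt_mul hF0]
    apply Real.sqrt_le_sqrt
    apply mul_le_mul hD _ (htail ▸ hB0) hF0
    nlinarith [sq_nonneg ε]
  refine ⟨h1, h2, ?_⟩
  have h8 : Real.sqrt (8 * ε) = 2 * Real.sqrt (2 * ε) := by
    rw [show 8 * ε = 2 ^ 2 * (2 * ε) by ring, Real.sqrt_mul (by norm_num),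
      Real.sqrt_sq (by norm_num)]
  rw [h8]
  linarith [h1.trans h2]
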